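/- For d ≥ 1 and 1 ≤ j ≤ d, the polynomial B^+_{d,j}(t) = Σ_{σ ∈ B_d, σ_1=j, σ_d>0} t^{des_B(σ)} has only real roots. -/

import Mathlib

/-- The signed value at position `i` of `f : Fin d → Fin d × Bool`. -/
def BVal (d : ℕ) (f : Fin d → Fin d × Bool) (i : Fin d) : ℤ :=
  if (f i).2 then ((f i).1 : ℤ) + 1 else -(((f i).1 : ℤ) + 1)

/-- `σ_{k+1}` in one-line notation (`k` is `0`-based); `0` out of range. -/
def sval (d : ℕ) (f : Fin d → Fin d × Bool) (k : ℕ) : ℤ :=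
  if h : k < d then BVal d f ⟨k, h⟩ else 0

/-- `f` encodes a signed permutation of `{1,…,d}`. -/
def IsSignedPerm (d : ℕ) (f : Fin d → Fin d × Bool) : Prop :=
  Function.Injective fun i => (f i).1

instance (d : ℕ) (f : Fin d → Fin d × Bool) : Decidable (IsSignedPerm d f) := by
  unfold IsSignedPerm; infer_instance

/-- The type-B descent number: `|{i ∈ [0,d−1] : σ_i > σ_{i+1}}|` with `σ_0 = 0`. -/
def desB (d : ℕ) (f : Fin d → Fin d × Bool) : ℕ :=
  ((Finset.range d).filter fun i =>
    sval d f i < if i = 0 then (0 : ℤ) else sval d f (i - 1)).card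

/-- Signed permutations with `σ_1 = j` and `σ_d > 0`. -/
def BplusSet (d : ℕ) (j : ℤ) : Finset (Fin d → Fin d × Bool) :=
  Finset.univ.filter fun f => IsSignedPerm d f ∧ sval d f 0 = j ∧ 0 < sval d f (d - 1)

/-- Signed permutations with `σ_1 = j` and `σ_d < 0`. -/
def BminusSet (d : ℕ) (j : ℤ) : Finset (Fin d → Fin d × Bool) :=
  Finset.univ.filter fun f => IsSignedPerm d f ∧ sval d f 0 = j ∧ sval d f (d - 1) < 0

open Polynomial

/-- The `j`-Eulerian polynomial of type `B^+`:
`B^+_{d,j}(t) = ∑_{σ ∈ B_d, σ_1=j, σ_d>0} t^{des_B(σ)}`. -/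
noncomputable def BplusPoly (d : ℕ) (j : ℤ) : Polynomial ℝ :=
  ∑ f ∈ BplusSet d j, X ^ desB d f

/-- The `j`-Eulerian polynomial of type `B^-`:
`B^−_{d,j}(t) = ∑_{σ ∈ B_d, σ_1=j, σ_d<0} t^{des_B(σ)}`. -/
noncomputable def BminusPoly (d : ℕ) (j : ℤ) : Polynomial ℝ :=
  ∑ f ∈ BminusSet d j, X ^ desB d f

/-- The `j`-Eulerian polynomial of type `B`:
`B_{d,j}(t) = ∑_{σ ∈ B_d, σ_1=j} t^{des_B(σ)}`. -/
noncomputable def BPoly (d : ℕ) (j : ℤ) : Polynomial ℝ :=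
  ∑ f ∈ Finset.univ.filter (fun f : Fin d → Fin d × Bool =>
      IsSignedPerm d f ∧ sval d f 0 = j), X ^ desB d f

/-- signed value of a letter -/
def vv (n : ℕ) (p : Fin n × Bool) : ℤ :=
  if p.2 then (p.1 : ℤ) + 1 else -((p.1 : ℤ) + 1)

/-- relabel the letters to avoid the letter `p` -/
def lft (n : ℕ) (p : Fin (n + 1) × Bool) (q : Fin n × Bool) : Fin (n + 1) × Bool :=
  (p.1.succAbove q.1, q.2)

/-- weight of a word: `z` to the number of descents at positions `1,…,n` -/
noncomputable def WW (z : ℂ) (n k : ℕ) (f : Fin (n + 1) → Fin k × Bool) : ℂ :=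
  ∏ i : Fin n, if vv k (f i.succ) < vv k (f i.castSucc) then z else 1

noncomputable def AA (z : ℂ) (n : ℕ) (p : Fin (n + 1) × Bool) : ℂ :=
  ∑ f ∈ Finset.univ.filter (fun f : Fin (n + 1) → Fin (n + 1) × Bool =>
    IsSignedPerm (n + 1) f ∧ f 0 = p ∧ (f (Fin.last n)).2 = true), WW z n (n + 1) f

lemma sA_val (n : ℕ) (a : Fin (n + 1)) (b : Fin n) :
    (a.succAbove b : ℕ) = if (b : ℕ) < a then (b : ℕ) else b + 1 := by
  unfold Fin.succAbove
  simp only [Fin.lt_def]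
  split_ifs <;> simp_all

lemma lft_lt (n : ℕ) (p : Fin (n + 1) × Bool) (q r : Fin n × Bool) :
    vv (n + 1) (lft n p q) < vv (n + 1) (lft n p r) ↔ vv n q < vv n r := by
  obtain ⟨a, s⟩ := p
  obtain ⟨b, t⟩ := q
  obtain ⟨c, u⟩ := r
  have h1 := sA_val n a b
  have h2 := sA_val n a c
  simp only [vv, lft]
  cases t <;> cases u <;> split_ifs at h1 h2 <;> simp <;> omega

lemma down (n : ℕ) (p p' : Fin (n + 1) × Bool) (q r : Fin n × Bool)
    (hp : vv (n + 1) p ≤ vv (n + 1) p')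
    (hq : vv (n + 1) (lft n p q) < vv (n + 1) p)
    (hr : ¬ vv (n + 1) (lft n p' r) < vv (n + 1) p') : vv n q ≤ vv n r := by
  obtain ⟨a, s⟩ := p
  obtain ⟨a', s'⟩ := p'
  obtain ⟨b, t⟩ := q
  obtain ⟨c, u⟩ := r
  have h1 := sA_val n a b
  have h2 := sA_val n a' c
  simp only [vv, lft] at *
  cases t <;> cases u <;> cases s <;> cases s' <;> simp at hp hq hr ⊢ <;> split_ifs at h1 h2 <;> omega

lemma mono (n : ℕ) (p p' : Fin (n + 1) × Bool) (q : Fin n × Bool)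
    (hp : vv (n + 1) p ≤ vv (n + 1) p')
    (hq : vv (n + 1) (lft n p q) < vv (n + 1) p) :
    vv (n + 1) (lft n p' q) < vv (n + 1) p' := by
  obtain ⟨a, s⟩ := p
  obtain ⟨a', s'⟩ := p'
  obtain ⟨b, t⟩ := q
  have h1 := sA_val n a b
  have h2 := sA_val n a' b
  simp only [vv, lft] at *
  cases t <;> cases s <;> cases s' <;> simp at hp hq ⊢ <;> split_ifs at h1 h2 <;> omega

/-- descent factor -/
noncomputable def cc (z : ℂ) (n : ℕ) (p : Fin (n + 1) × Bool) (q : Fin n × Bool) : ℂ :=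
  if vv (n + 1) (lft n p q) < vv (n + 1) p then z else 1

lemma AA_succ (z : ℂ) (n : ℕ) (p : Fin (n + 2) × Bool) :
    AA z (n + 1) p = ∑ q, cc z (n + 1) p q * AA z n q := by
  have hR : ∑ q, cc z (n + 1) p q * AA z n q =
      ∑ f ∈ Finset.univ.filter (fun f : Fin (n + 1) → Fin (n + 1) × Bool =>
        IsSignedPerm (n + 1) f ∧ (f (Fin.last n)).2 = true),
        cc z (n + 1) p (f 0) * WW z n (n + 1) f := by
    simp only [AA, Finset.mul_sum, Finset.sum_filter]
    rw [Finset.sum_comm]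
    refine Finset.sum_congr rfl fun f _ => ?_
    rw [Finset.sum_eq_single (f 0)]
    · simp
    · intro b _ hb
      rw [if_neg (fun h => hb h.2.1.symm)]
      try exact mul_zero _
    · simp
  rw [hR]
  symm
  unfold AA
  refine Finset.sum_bij (fun f _ => Fin.cons p (fun i => lft (n + 1) p (f i))) ?_ ?_ ?_ ?_
  · intro f hf
    simp only [Finset.mem_filter, Finset.mem_univ, true_and] at hf ⊢
    obtain ⟨h1, h2⟩ := hf
    refine ⟨?_, by simp, ?_⟩
    · intro i j hij
      induction i using Fin.cases with
      | zero =>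
        induction j using Fin.cases with
        | zero => rfl
        | succ j =>
          simp only [Fin.cons_zero, Fin.cons_succ, lft] at hij
          exact absurd hij.symm (Fin.succAbove_ne _ _)
      | succ i =>
        induction j using Fin.cases with
        | zero =>
          simp only [Fin.cons_zero, Fin.cons_succ, lft] at hij
          exact absurd hij (Fin.succAbove_ne _ _)
        | succ j =>
          simp only [Fin.cons_succ, lft] at hij
          rw [h1 (Fin.succAbove_right_injective hij)]
    · rw [← Fin.succ_last, Fin.cons_succ]
      exact h2
  · intro f _ g _ h
    have h' := (Fin.cons_injective2 h).2
    funext i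
    have := congrFun h' i
    simp only [lft, Prod.mk.injEq] at this
    exact Prod.ext (Fin.succAbove_right_injective this.1) this.2
  · intro g hg
    simp only [Finset.mem_filter, Finset.mem_univ, true_and] at hg
    obtain ⟨h1, h2, h3⟩ := hg
    have hex : ∀ i : Fin (n + 1), ∃ y, p.1.succAbove y = (g i.succ).1 := by
      intro i
      apply Fin.exists_succAbove_eq
      intro h
      rw [← h2] at h
      exact absurd (h1 h) (Fin.succ_ne_zero i)
    choose y hy using hex
    refine ⟨fun i => (y i, (g i.succ).2), ?_, ?_⟩
    · simp only [Finset.mem_filter, Finset.mem_univ, true_and]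
      refine ⟨?_, ?_⟩
      · intro i j hij
        have : y i = y j := hij
        have h4 : (g i.succ).1 = (g j.succ).1 := by rw [← hy, ← hy, this]
        exact Fin.succ_injective _ (h1 h4)
      · rw [Fin.succ_last]; exact h3
    · funext i
      induction i using Fin.cases with
      | zero => simp [h2]
      | succ i =>
        simp only [Fin.cons_succ, lft, hy]
  · intro f _
    conv_rhs => unfold WW
    rw [Fin.prod_univ_succ]
    unfold cc WW
    congr 1
    refine Finset.prod_congr rfl fun i _ => ?_
    simp only [Fin.cons_succ, ← Fin.succ_castSucc, lft_lt]

/-- pointwise interlacing -/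
def ZRel (z u v : ℂ) : Prop :=
  0 ≤ (v * (starRingEnd ℂ) u).im ∧ 0 ≤ (z * u * (starRingEnd ℂ) v).im

lemma Rel_refl (z u : ℂ) (hz : 0 < z.im) : ZRel z u u := by
  constructor
  · simp [mul_comm]
  · rw [mul_assoc, Complex.mul_conj, Complex.im_mul_ofReal]
    exact mul_nonneg hz.le (Complex.normSq_nonneg _)

lemma Rel_sum {ι : Type*} (z : ℂ) (S T : Finset ι) (f : ι → ℂ)
    (h : ∀ i ∈ S, ∀ j ∈ T, ZRel z (f i) (f j)) : ZRel z (∑ i ∈ S, f i) (∑ j ∈ T, f j) := by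
  constructor
  · rw [map_sum, Finset.sum_mul_sum, Complex.im_sum]
    refine Finset.sum_nonneg fun j hj => ?_
    rw [Complex.im_sum]
    exact Finset.sum_nonneg fun i hi => (h i hi j hj).1
  · rw [map_sum, Finset.mul_sum S, Finset.sum_mul_sum, Complex.im_sum]
    refine Finset.sum_nonneg fun j hj => ?_
    rw [Complex.im_sum]
    exact Finset.sum_nonneg fun i hi => (h j hj i hi).2

lemma Rel_step (z A B C : ℂ) (hz : 0 < z.im) (hAB : ZRel z A B) (hAC : ZRel z A C)
    (hBC : ZRel z B C) : ZRel z (z * A + B + C) (z * A + z * B + C) := by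
  obtain ⟨h1, h2⟩ := hAB
  obtain ⟨h5, h6⟩ := hBC
  have hN := Complex.normSq_nonneg z
  constructor
  · have e : ((z * A + z * B + C) * (starRingEnd ℂ) (z * A + B + C)).im =
      (z * A * (starRingEnd ℂ) B).im + Complex.normSq z * (B * (starRingEnd ℂ) A).im
      + z.im * Complex.normSq B + (z * B * (starRingEnd ℂ) C).im + (C * (starRingEnd ℂ) B).im := by
      simp [Complex.normSq_apply]; ring
    rw [e]
    have := mul_nonneg hz.le (Complex.normSq_nonneg B)
    have := mul_nonneg hN h1
    linarith
  · have e : (z * (z * A + B + C) * (starRingEnd ℂ) (z * A + z * B + C)).im =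
      z.im * Complex.normSq (z * A + C) + Complex.normSq z * (z * A * (starRingEnd ℂ) B).im
      + Complex.normSq z * (B * (starRingEnd ℂ) A).im + (z * B * (starRingEnd ℂ) C).im
      + Complex.normSq z * (C * (starRingEnd ℂ) B).im := by
      simp [Complex.normSq_apply]; ring
    rw [e]
    have := mul_nonneg hz.le (Complex.normSq_nonneg (z * A + C))
    have := mul_nonneg hN h1
    have := mul_nonneg hN h2
    have := mul_nonneg hN h5
    linarith

lemma Rel_zero (z A B : ℂ) (hz : 0 < z.im) (h : ZRel z A B) (h0 : z * A + B = 0) :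
    A + B = 0 := by
  have hB : B = -(z * A) := by linear_combination h0
  have h1 := h.1
  have e : (B * (starRingEnd ℂ) A).im = - (z.im * Complex.normSq A) := by
    rw [hB]; simp [Complex.normSq_apply]; ring
  rw [e] at h1
  have h2 := mul_nonneg hz.le (Complex.normSq_nonneg A)
  have h3 : z.im * Complex.normSq A = 0 := by linarith
  have h4 : A = 0 := by
    rcases mul_eq_zero.1 h3 with h | h
    · exact absurd h hz.ne'
    · exact Complex.normSq_eq_zero.1 h
  subst h4
  simpa using h0

lemma Rel_pos (z u v : ℂ) (hz : 0 < z.im) (h : ZRel z u v)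
    (h0 : (v * (starRingEnd ℂ) u).im = 0) : 0 ≤ (v * (starRingEnd ℂ) u).re := by
  have h2 := h.2
  have e : (z * u * (starRingEnd ℂ) v).im =
      z.im * (v * (starRingEnd ℂ) u).re - z.re * (v * (starRingEnd ℂ) u).im := by
    simp; ring
  rw [e, h0] at h2
  have : 0 ≤ z.im * (v * (starRingEnd ℂ) u).re := by linarith
  exact nonneg_of_mul_nonneg_right this hz

lemma sum_ne {ι : Type*} [Fintype ι] (z : ℂ) (hz : 0 < z.im) (w : ι → ℤ) (f : ι → ℂ)
    (h : ∀ i j, w i ≤ w j → ZRel z (f i) (f j)) (hne : ∃ i, f i ≠ 0) : ∑ i, f i ≠ 0 := by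
  classical
  intro h0
  obtain ⟨i0, hi0⟩ := hne
  obtain ⟨a, ha, hmin⟩ := Finset.exists_min_image (Finset.univ.filter fun i => f i ≠ 0) w
    ⟨i0, by simpa using hi0⟩
  have ha' : f a ≠ 0 := by simpa using ha
  have hR : ∀ j, ZRel z (f a) (f j) := by
    intro j
    by_cases hj : f j = 0
    · rw [hj]; simp [ZRel]
    · exact h a j (hmin j (by simpa using hj))
  have hs : ∑ j, f j * (starRingEnd ℂ) (f a) = 0 := by rw [← Finset.sum_mul, h0, zero_mul]
  have him := congrArg Complex.im hs
  have hre := congrArg Complex.re hs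
  rw [Complex.im_sum, Complex.zero_im, Finset.sum_eq_zero_iff_of_nonneg (fun j _ => (hR j).1)] at him
  rw [Complex.re_sum, Complex.zero_re, Finset.sum_eq_zero_iff_of_nonneg
    (fun j _ => Rel_pos z _ _ hz (hR j) (him j (Finset.mem_univ _)))] at hre
  have := hre a (Finset.mem_univ _)
  rw [Complex.mul_conj, Complex.ofReal_re] at this
  exact ha' (Complex.normSq_eq_zero.1 this)

lemma main_inv (z : ℂ) (hz : 0 < z.im) (n : ℕ) :
    (∀ p q, vv (n + 1) p ≤ vv (n + 1) q → ZRel z (AA z n p) (AA z n q)) ∧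
    (∀ p : Fin (n + 1) × Bool, p.2 = true → AA z n p ≠ 0) := by
  induction n with
  | zero =>
    have h0 : AA z 0 (0, false) = 0 := by
      unfold AA
      apply Finset.sum_eq_zero
      intro f hf
      simp only [Finset.mem_filter, Finset.mem_univ, true_and] at hf
      obtain ⟨_, h1, h2⟩ := hf
      rw [show Fin.last 0 = 0 from rfl, h1] at h2
      simp at h2
    have h1 : AA z 0 (0, true) = 1 := by
      unfold AA
      rw [Finset.sum_eq_single (fun _ => (0, true))]
      · simp [WW]
      · intro f hf hne
        simp only [Finset.mem_filter, Finset.mem_univ, true_and] at hf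
        exact absurd (_root_.funext fun i => by rw [show i = 0 from Fin.ext (by omega)]; exact hf.2.1) hne
      · intro h
        exfalso
        apply h
        simp only [Finset.mem_filter, Finset.mem_univ, true_and, and_true]
        exact fun i j _ => Fin.ext (by omega)
    constructor
    · rintro ⟨a, s⟩ ⟨b, t⟩ h
      obtain rfl : a = 0 := Fin.ext (by omega)
      obtain rfl : b = 0 := Fin.ext (by omega)
      cases s <;> cases t
      · exact Rel_refl _ _ hz
      · rw [h0]; simp [ZRel]
      · rw [h0]; simp [ZRel]
      · exact Rel_refl _ _ hz
    · rintro ⟨a, s⟩ rfl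
      obtain rfl : a = 0 := Fin.ext (by omega)
      rw [h1]; exact one_ne_zero
  | succ n ih =>
    obtain ⟨ih1, ih2⟩ := ih
    classical
    constructor
    · intro p p' hp
      let S := Finset.univ.filter fun q => vv (n + 2) (lft (n + 1) p q) < vv (n + 2) p
      let T := Finset.univ.filter fun q => ¬ vv (n + 2) (lft (n + 1) p q) < vv (n + 2) p ∧
        vv (n + 2) (lft (n + 1) p' q) < vv (n + 2) p'
      let U := Finset.univ.filter fun q => ¬ vv (n + 2) (lft (n + 1) p' q) < vv (n + 2) p'
      have hA : AA z (n + 1) p = z * ∑ q ∈ S, AA z n q + ∑ q ∈ T, AA z n q + ∑ q ∈ U, AA z n q := by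
        rw [AA_succ, Finset.mul_sum]
        simp only [S, T, U, Finset.sum_filter, ← Finset.sum_add_distrib]
        refine Finset.sum_congr rfl fun q _ => ?_
        have := mono (n + 1) p p' q hp
        unfold cc
        by_cases h1 : vv (n + 2) (lft (n + 1) p q) < vv (n + 2) p
        · have h2 := this h1
          simp [h1, h2]
        · by_cases h2 : vv (n + 2) (lft (n + 1) p' q) < vv (n + 2) p' <;> simp [h1, h2]
      have hB : AA z (n + 1) p' =
          z * ∑ q ∈ S, AA z n q + z * ∑ q ∈ T, AA z n q + ∑ q ∈ U, AA z n q := by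
        rw [AA_succ, Finset.mul_sum, Finset.mul_sum]
        simp only [S, T, U, Finset.sum_filter, ← Finset.sum_add_distrib]
        refine Finset.sum_congr rfl fun q _ => ?_
        have := mono (n + 1) p p' q hp
        unfold cc
        by_cases h1 : vv (n + 2) (lft (n + 1) p q) < vv (n + 2) p
        · have h2 := this h1
          simp [h1, h2]
        · by_cases h2 : vv (n + 2) (lft (n + 1) p' q) < vv (n + 2) p' <;> simp [h1, h2]
      rw [hA, hB]
      apply Rel_step _ _ _ _ hz
      · refine Rel_sum _ _ _ _ fun q hq r hr => ih1 _ _ ?_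
        simp only [S, T, Finset.mem_filter, Finset.mem_univ, true_and] at hq hr
        exact down _ p p _ _ le_rfl hq hr.1
      · refine Rel_sum _ _ _ _ fun q hq r hr => ih1 _ _ ?_
        simp only [S, U, Finset.mem_filter, Finset.mem_univ, true_and] at hq hr
        exact down _ p p' _ _ hp hq hr
      · refine Rel_sum _ _ _ _ fun q hq r hr => ih1 _ _ ?_
        simp only [T, U, Finset.mem_filter, Finset.mem_univ, true_and] at hq hr
        exact down _ p' p' _ _ le_rfl hq.2 hr
    · intro p _ h0
      let S := Finset.univ.filter fun q => vv (n + 2) (lft (n + 1) p q) < vv (n + 2) p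
      let U := Finset.univ.filter fun q => ¬ vv (n + 2) (lft (n + 1) p q) < vv (n + 2) p
      have hA : AA z (n + 1) p = z * ∑ q ∈ S, AA z n q + ∑ q ∈ U, AA z n q := by
        rw [AA_succ, Finset.mul_sum]
        simp only [S, U, Finset.sum_filter, ← Finset.sum_add_distrib]
        refine Finset.sum_congr rfl fun q _ => ?_
        unfold cc
        by_cases h1 : vv (n + 2) (lft (n + 1) p q) < vv (n + 2) p <;> simp [h1]
      have hR : ZRel z (∑ q ∈ S, AA z n q) (∑ q ∈ U, AA z n q) := by
        refine Rel_sum _ _ _ _ fun q hq r hr => ih1 _ _ ?_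
        simp only [S, U, Finset.mem_filter, Finset.mem_univ, true_and] at hq hr
        exact down _ p p _ _ le_rfl hq hr
      rw [hA] at h0
      have h2 := Rel_zero z _ _ hz hR h0
      rw [Finset.sum_filter_add_sum_filter_not] at h2
      exact sum_ne z hz (vv (n + 1)) _ ih1 ⟨(0, true), ih2 _ rfl⟩ h2

lemma Bplus_eq (z : ℂ) (n : ℕ) (a : Fin (n + 1)) :
    Polynomial.aeval z (BplusPoly (n + 1) ((a : ℕ) + 1 : ℤ)) = AA z n (a, true) := by
  unfold BplusPoly AA
  rw [map_sum]
  have hv : ∀ (f : Fin (n + 1) → Fin (n + 1) × Bool) (i : Fin (n + 1)),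
      sval (n + 1) f i = vv (n + 1) (f i) := by
    intro f i
    unfold sval
    rw [dif_pos i.isLt]
    rfl
  have hset : BplusSet (n + 1) ((a : ℕ) + 1 : ℤ) =
      Finset.univ.filter (fun f : Fin (n + 1) → Fin (n + 1) × Bool =>
        IsSignedPerm (n + 1) f ∧ f 0 = (a, true) ∧ (f (Fin.last n)).2 = true) := by
    unfold BplusSet
    refine Finset.filter_congr fun f _ => ?_
    have e0 := hv f 0
    have e1 := hv f (Fin.last n)
    simp only [Fin.val_zero, Fin.val_last] at e0 e1
    rw [Nat.add_sub_cancel, e0, e1]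
    refine and_congr_right fun _ => and_congr ?_ ?_
    · generalize f 0 = p
      obtain ⟨b, s⟩ := p
      cases s
      · simp [vv]; omega
      · simp [vv, Fin.ext_iff]
    · generalize f (Fin.last n) = p
      obtain ⟨b, s⟩ := p
      cases s
      · simp [vv] <;> omega
      · simp [vv] <;> omega
  rw [hset]
  refine Finset.sum_congr rfl fun f hf => ?_
  simp only [Finset.mem_filter, Finset.mem_univ, true_and] at hf
  rw [map_pow, Polynomial.aeval_X]
  unfold desB WW
  rw [← Finset.prod_const, Finset.prod_filter, Finset.prod_range, Fin.prod_univ_succ]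
  have e0 := hv f 0
  simp only [Fin.val_zero] at e0
  rw [if_neg, one_mul]
  · refine Finset.prod_congr rfl fun i _ => ?_
    have e1 := hv f i.succ
    have e2 := hv f i.castSucc
    simp only [Fin.val_succ, Fin.val_castSucc] at e1 e2
    simp [e1, e2]
  · simp only [Fin.val_zero, if_true]
    rw [e0, hf.2.1]
    simp [vv]; omega

/-- for `d ≥ 1` and `1 ≤ j ≤ d`, the polynomial
`B^+_{d,j}(t) = ∑_{σ ∈ B_d, σ_1=j, σ_d>0} t^{des_B(σ)}` has only real roots:
every complex root is real. -/
theorem BplusPoly_real_rooted (d j : ℕ) (hd : 1 ≤ d) (hj : 1 ≤ j) (hjd : j ≤ d) :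
    ∀ z : ℂ, Polynomial.aeval z (BplusPoly d (j : ℤ)) = 0 → ∃ x : ℝ, z = (x : ℂ) := by
  intro z hz
  obtain ⟨n, rfl⟩ : ∃ n, d = n + 1 := ⟨d - 1, by omega⟩
  obtain ⟨k, rfl⟩ : ∃ k, j = k + 1 := ⟨j - 1, by omega⟩
  have key : ∀ w : ℂ, 0 < w.im →
      Polynomial.aeval w (BplusPoly (n + 1) ((k + 1 : ℕ) : ℤ)) ≠ 0 := by
    intro w hw
    have h := Bplus_eq w n ⟨k, by omega⟩
    simp only at h
    rw [Nat.cast_add, Nat.cast_one, h]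
    exact (main_inv w hw n).2 _ rfl
  rcases lt_trichotomy z.im 0 with h | h | h
  · exfalso
    refine key ((starRingEnd ℂ) z) (by simpa using h) ?_
    rw [Polynomial.aeval_conj, hz, map_zero]
  · exact ⟨z.re, by apply Complex.ext <;> simp [h]⟩
  · exact absurd hz (key z h)
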